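/- Let k ≥ 1 be a fixed integer, p(n) = (log n + (k+1)·log log n − log log log n)/n and D = log n / log log n. Fix an integer t ≥ 1 and a real number 0 < α < 1. Then almost surely G(n, p(n)) contains no vertex subset S with |S| ≤ α·t·D and e[S] ≥ |S| + t, where e[S] is the number of edges of the subgraph induced by S. -/

import Mathlib

open Filter Asymptotics
open scoped Classical

noncomputable section

/-- The number of edges of a simple graph on a finite vertex type. -/
def edgeCount {V : Type*} [Fintype V] (G : SimpleGraph V) : ℕ :=
  G.edgeFinset.card

/-- Probability in the Erdős–Rényi model `G(n,p)` of a set `A` of graphs on `Fin n`: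
each of the `n.choose 2` possible edges is present independently with probability `p`. -/
def gnpProb (n : ℕ) (p : ℝ) (A : Set (SimpleGraph (Fin n))) : ℝ :=
  ∑ G ∈ Finset.univ.filter (fun G => G ∈ A),
    p ^ edgeCount G * (1 - p) ^ (n.choose 2 - edgeCount G)

/-- Probability in the uniform model `G(n,M)` of a set `A` of graphs on `Fin n`:
all graphs with exactly `M` edges are equally likely. -/
def gnmProb (n M : ℕ) (A : Set (SimpleGraph (Fin n))) : ℝ :=
  ((Finset.univ.filter (fun G : SimpleGraph (Fin n) => edgeCount G = M ∧ G ∈ A)).card : ℝ) /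
    ((Finset.univ.filter (fun G : SimpleGraph (Fin n) => edgeCount G = M)).card : ℝ)

/-- `κ(S)`: the largest number of internally disjoint trees connecting `S`, i.e. trees
`T₁, …, T_k` of `G` with `S ⊆ V(Tᵢ)`, `V(Tᵢ) ∩ V(Tⱼ) = S` and `E(Tᵢ) ∩ E(Tⱼ) = ∅`
for `i ≠ j`. -/
def kappaSet {V : Type*} (G : SimpleGraph V) (S : Set V) : ℕ :=
  sSup {k | ∃ T : Fin k → G.Subgraph,
    (∀ i, S ⊆ (T i).verts ∧ ((T i).coe).IsTree) ∧
    (∀ i j, i ≠ j → (T i).verts ∩ (T j).verts = S ∧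
      (T i).edgeSet ∩ (T j).edgeSet = ∅)}

/-- `λ(S)`: the largest number of pairwise edge-disjoint trees of `G` each containing `S`. -/
def lambdaSet {V : Type*} (G : SimpleGraph V) (S : Set V) : ℕ :=
  sSup {k | ∃ T : Fin k → G.Subgraph,
    (∀ i, S ⊆ (T i).verts ∧ ((T i).coe).IsTree) ∧
    (∀ i j, i ≠ j → (T i).edgeSet ∩ (T j).edgeSet = ∅)}

/-- The generalized `r`-connectivity `κ_r(G)`: the minimum of `κ(S)` over `r`-subsets `S`,
and `0` if `G` is disconnected. -/
def genKappa {V : Type*} [Fintype V] (r : ℕ) (G : SimpleGraph V) : ℕ :=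
  if G.Connected then
    sInf {k | ∃ S : Finset V, S.card = r ∧ kappaSet G ↑S = k}
  else 0

/-- The generalized `r`-edge-connectivity `λ_r(G)`: the minimum of `λ(S)` over
`r`-subsets `S`, and `0` if `G` is disconnected. -/
def genLambda {V : Type*} [Fintype V] (r : ℕ) (G : SimpleGraph V) : ℕ :=
  if G.Connected then
    sInf {k | ∃ S : Finset V, S.card = r ∧ lambdaSet G ↑S = k}
  else 0

/-- The vertex connectivity `κ(G)`: the largest `k` such that `G` is `k`-connected,
i.e. `k < |V|` and the removal of fewer than `k` vertices leaves a connected graph. -/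
def vertexConnectivity {V : Type*} [Fintype V] (G : SimpleGraph V) : ℕ :=
  sSup {k | k < Fintype.card V ∧
    ∀ S : Finset V, S.card < k → (G.induce ((↑S : Set V)ᶜ)).Connected}

/-- The edge connectivity `λ(G)`: the largest `k` such that removing fewer than `k`
edges always leaves a connected graph. -/
def edgeConnectivity {V : Type*} [Fintype V] (G : SimpleGraph V) : ℕ :=
  sSup {k | ∀ F : Finset (Sym2 V), F.card < k → (G.deleteEdges ↑F).Connected}

/-- The minimum degree `δ(G)`. -/
def minDeg {V : Type*} [Fintype V] (G : SimpleGraph V) : ℕ :=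
  G.minDegree

/-- The number of children of `v` in the graph `H` viewed as rooted at `r`:
neighbours of `v` lying one step further from the root. -/
def childCount {W : Type*} (H : SimpleGraph W) (r v : W) : ℕ :=
  {w | H.Adj v w ∧ H.dist r w = H.dist r v + 1}.ncard

/-- The depth of the graph `H` viewed as rooted at `r`: the largest distance from `r`. -/
def rootedDepth {W : Type*} (H : SimpleGraph W) (r : W) : ℕ :=
  sSup (Set.range (H.dist r))

/-- `T` is a subtree of `G` rooted at `r`, of depth `d`, in which every non-leaf
vertex has exactly `t` children (a `t`-ary tree of depth `d`). -/
def IsAryTreeOfDepth {V : Type*} {G : SimpleGraph V} (T : G.Subgraph) (r : V)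
    (t d : ℕ) : Prop :=
  ∃ hr : r ∈ T.verts,
    T.coe.IsTree ∧ rootedDepth T.coe ⟨r, hr⟩ = d ∧
      ∀ v : T.verts, childCount T.coe ⟨r, hr⟩ v = 0 ∨ childCount T.coe ⟨r, hr⟩ v = t

end

/-- The potential edges on `Fin n`, i.e. the non-diagonal unordered pairs, number `n.choose 2`. -/
lemma exists_finset_not_isDiag (n : ℕ) : ∃ E : Finset (Sym2 (Fin n)),
    (∀ e, e ∈ E ↔ ¬ e.IsDiag) ∧ E.card = n.choose 2 := by
  refine ⟨(⊤ : SimpleGraph (Fin n)).edgeFinset, fun e => ?_, ?_⟩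
  · simp
  · rw [SimpleGraph.card_edgeFinset_top_eq_card_choose_two, Fintype.card_fin]

lemma edgeSet_fromEdgeSet_of_not_isDiag {V : Type*} {X : Set (Sym2 V)}
    (hX : ∀ e ∈ X, ¬ e.IsDiag) : (SimpleGraph.fromEdgeSet X).edgeSet = X := by
  ext e
  have := hX e
  simpa using this

lemma edgeFinset_eq_of_edgeSet_eq {V : Type*} [Fintype V] {G : SimpleGraph V}
    {_ : Fintype G.edgeSet} {X : Finset (Sym2 V)} (h : G.edgeSet = X) : G.edgeFinset = X := by
  ext e
  rw [SimpleGraph.mem_edgeFinset, h, Finset.mem_coe]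

lemma edgeCount_fromEdgeSet {V : Type*} [Fintype V] {X : Finset (Sym2 V)}
    (hX : ∀ e ∈ X, ¬ e.IsDiag) :
    edgeCount (SimpleGraph.fromEdgeSet (X : Set (Sym2 V))) = X.card :=
  congrArg Finset.card (edgeFinset_eq_of_edgeSet_eq (edgeSet_fromEdgeSet_of_not_isDiag hX))

/-- Summing over all graphs is summing over all sets of potential edges. -/
lemma sum_simpleGraph_eq_sum_powerset {V : Type*} [Fintype V] [Fintype (SimpleGraph V)]
    {E : Finset (Sym2 V)} (hE : ∀ e, e ∈ E ↔ ¬ e.IsDiag) (f : SimpleGraph V → ℝ) :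
    ∑ G : SimpleGraph V, f G =
      ∑ X ∈ E.powerset, f (SimpleGraph.fromEdgeSet (X : Set (Sym2 V))) := by
  symm
  refine Finset.sum_bij' (fun X _ => SimpleGraph.fromEdgeSet (X : Set (Sym2 V)))
    (fun G _ => G.edgeFinset) ?_ ?_ ?_ ?_ ?_
  · intro X _
    exact Finset.mem_univ _
  · intro G _
    rw [Finset.mem_powerset]
    intro e he
    exact (hE e).2 (G.not_isDiag_of_mem_edgeSet (SimpleGraph.mem_edgeFinset.1 he))
  · intro X hX
    exact edgeFinset_eq_of_edgeSet_eq (edgeSet_fromEdgeSet_of_not_isDiag fun e he =>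
      (hE e).1 (Finset.mem_powerset.1 hX he))
  · intro G _
    simp
  · intro X _
    rfl

lemma gnpProb_add_compl (n : ℕ) (p : ℝ) (A : Set (SimpleGraph (Fin n))) :
    gnpProb n p A + gnpProb n p Aᶜ = 1 := by
  obtain ⟨E, hE, hEc⟩ := exists_finset_not_isDiag n
  have h : gnpProb n p A + gnpProb n p Aᶜ = ∑ G : SimpleGraph (Fin n),
      p ^ edgeCount G * (1 - p) ^ (n.choose 2 - edgeCount G) := by
    rw [gnpProb, gnpProb]
    simp only [Set.mem_compl_iff]
    exact Finset.sum_filter_add_sum_filter_not _ _ _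
  rw [h, sum_simpleGraph_eq_sum_powerset hE]
  have hX : ∀ X ∈ E.powerset,
      p ^ edgeCount (SimpleGraph.fromEdgeSet (X : Set (Sym2 (Fin n)))) * (1 - p) ^
        (n.choose 2 - edgeCount (SimpleGraph.fromEdgeSet (X : Set (Sym2 (Fin n))))) =
      p ^ X.card * (1 - p) ^ (E.card - X.card) := by
    intro X hX
    rw [edgeCount_fromEdgeSet fun e he => (hE e).1 (Finset.mem_powerset.1 hX he), hEc]
  rw [Finset.sum_congr rfl hX, Finset.sum_pow_mul_eq_add_pow]
  simp

/-- A given set `F` of potential edges is present with probability `p ^ F.card`. -/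
lemma gnpProb_subset_edgeSet (n : ℕ) (p : ℝ) (F : Finset (Sym2 (Fin n)))
    (hF : ∀ e ∈ F, ¬ e.IsDiag) :
    gnpProb n p {G | (F : Set (Sym2 (Fin n))) ⊆ G.edgeSet} = p ^ F.card := by
  obtain ⟨E, hE, hEc⟩ := exists_finset_not_isDiag n
  have hFE : F ⊆ E := fun e he => (hE e).2 (hF e he)
  rw [gnpProb, Finset.sum_filter, sum_simpleGraph_eq_sum_powerset hE, ← Finset.sum_filter]
  have h : ∑ X ∈ E.powerset.filter (fun X : Finset (Sym2 (Fin n)) =>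
        SimpleGraph.fromEdgeSet (X : Set (Sym2 (Fin n))) ∈
          {G : SimpleGraph (Fin n) | (F : Set (Sym2 (Fin n))) ⊆ G.edgeSet}),
      p ^ edgeCount (SimpleGraph.fromEdgeSet (X : Set (Sym2 (Fin n)))) * (1 - p) ^
        (n.choose 2 - edgeCount (SimpleGraph.fromEdgeSet (X : Set (Sym2 (Fin n))))) =
      ∑ Y ∈ (E \ F).powerset,
        p ^ F.card * (p ^ Y.card * (1 - p) ^ ((E \ F).card - Y.card)) := by
    have hdiag : ∀ X ⊆ E, ∀ e ∈ X, ¬ e.IsDiag := fun X hX e he => (hE e).1 (hX he)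
    have hmem : ∀ X ⊆ E, (SimpleGraph.fromEdgeSet (X : Set (Sym2 (Fin n))) ∈
        {G : SimpleGraph (Fin n) | (F : Set (Sym2 (Fin n))) ⊆ G.edgeSet} ↔ F ⊆ X) := by
      intro X hX
      rw [Set.mem_ofPred_eq, edgeSet_fromEdgeSet_of_not_isDiag (by exact_mod_cast hdiag X hX),
        Finset.coe_subset]
    symm
    refine Finset.sum_bij' (fun Y _ => F ∪ Y) (fun X _ => X \ F) ?_ ?_ ?_ ?_ ?_
    · intro Y hY
      rw [Finset.mem_powerset] at hY
      have hsub : F ∪ Y ⊆ E := Finset.union_subset hFE (hY.trans Finset.sdiff_subset)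
      rw [Finset.mem_filter, Finset.mem_powerset, hmem _ hsub]
      exact ⟨hsub, Finset.subset_union_left⟩
    · intro X hX
      rw [Finset.mem_filter, Finset.mem_powerset] at hX
      exact Finset.mem_powerset.2 (Finset.sdiff_subset_sdiff hX.1 le_rfl)
    · intro Y hY
      rw [Finset.mem_powerset] at hY
      exact Finset.union_sdiff_cancel_left (Finset.disjoint_sdiff.mono_right hY)
    · intro X hX
      rw [Finset.mem_filter, Finset.mem_powerset] at hX
      exact Finset.union_sdiff_of_subset ((hmem X hX.1).1 hX.2)
    · intro Y hY
      rw [Finset.mem_powerset] at hY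
      have hsub : F ∪ Y ⊆ E := Finset.union_subset hFE (hY.trans Finset.sdiff_subset)
      rw [edgeCount_fromEdgeSet (hdiag _ hsub), ← hEc,
        Finset.card_union_of_disjoint (Finset.disjoint_sdiff.mono_right hY),
        Finset.card_sdiff_of_subset hFE, pow_add, mul_assoc, Nat.sub_sub]
  rw [h, ← Finset.mul_sum, Finset.sum_pow_mul_eq_add_pow]
  simp

lemma gnpProb_nonneg (n : ℕ) {p : ℝ} (hp0 : 0 ≤ p) (hp1 : p ≤ 1)
    (A : Set (SimpleGraph (Fin n))) : 0 ≤ gnpProb n p A :=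
  Finset.sum_nonneg fun _ _ =>
    mul_nonneg (pow_nonneg hp0 _) (pow_nonneg (sub_nonneg.2 hp1) _)

/-- The union bound in `G(n,p)`. -/
lemma gnpProb_le_sum {ι : Type*} (n : ℕ) {p : ℝ} (hp0 : 0 ≤ p) (hp1 : p ≤ 1)
    (A : Set (SimpleGraph (Fin n))) (I : Finset ι) (B : ι → Set (SimpleGraph (Fin n)))
    (h : ∀ G ∈ A, ∃ i ∈ I, G ∈ B i) :
    gnpProb n p A ≤ ∑ i ∈ I, gnpProb n p (B i) := by
  simp_rw [gnpProb, Finset.sum_filter]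
  rw [Finset.sum_comm]
  refine Finset.sum_le_sum fun G _ => ?_
  have hw : 0 ≤ p ^ edgeCount G * (1 - p) ^ (n.choose 2 - edgeCount G) :=
    mul_nonneg (pow_nonneg hp0 _) (pow_nonneg (sub_nonneg.2 hp1) _)
  have hnn : ∀ i ∈ I, 0 ≤ if G ∈ B i then
      p ^ edgeCount G * (1 - p) ^ (n.choose 2 - edgeCount G) else 0 := by
    intro i _
    split_ifs
    · exact hw
    · exact le_rfl
  by_cases hG : G ∈ A
  · obtain ⟨i, hi, hGi⟩ := h G hG
    refine le_trans ?_ (Finset.single_le_sum hnn hi)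
    rw [if_pos hG, if_pos hGi]
  · rw [if_neg hG]
    exact Finset.sum_nonneg hnn

/-- If `G[S]` has at least `m` edges, then `G` contains a set of `m` edges inside `S`. -/
lemma exists_edges_of_le_edgeCount_induce {n : ℕ} (G : SimpleGraph (Fin n))
    (S : Finset (Fin n)) (m : ℕ) (h : m ≤ edgeCount (G.induce (↑S : Set (Fin n)))) :
    ∃ F ∈ Finset.powersetCard m (S.sym2.filter fun e => ¬ e.IsDiag),
      (F : Set (Sym2 (Fin n))) ⊆ G.edgeSet := by
  obtain ⟨F, hF, hFc⟩ := Finset.exists_subset_card_eq h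
  have hinj : Function.Injective (Sym2.map (Subtype.val : (↑S : Set (Fin n)) → Fin n)) :=
    Sym2.map.injective Subtype.val_injective
  have key : ∀ e ∈ F.image (Sym2.map Subtype.val), e ∈ G.edgeSet ∧ e ∈ S.sym2 := by
    intro e he
    obtain ⟨d, hd, rfl⟩ := Finset.mem_image.1 he
    have hd' := hF hd
    induction d using Sym2.ind with
    | _ x y =>
      rw [SimpleGraph.mem_edgeFinset, SimpleGraph.mem_edgeSet] at hd'
      refine ⟨?_, ?_⟩
      · rw [Sym2.map_mk, SimpleGraph.mem_edgeSet]
        exact hd'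
      · rw [Sym2.map_mk, Finset.mk_mem_sym2_iff]
        exact ⟨x.2, y.2⟩
  refine ⟨F.image (Sym2.map Subtype.val), Finset.mem_powersetCard.2 ⟨?_, ?_⟩,
    fun e he => (key e (Finset.mem_coe.1 he)).1⟩
  · intro e he
    exact Finset.mem_filter.2 ⟨(key e he).2, G.not_isDiag_of_mem_edgeSet (key e he).1⟩
  · rw [Finset.card_image_of_injective _ hinj, hFc]

/-- First-moment bound for the existence of a vertex set of size at most `M` spanning
at least `t` more edges than vertices. -/
lemma gnpProb_exists_dense_le (n t M : ℕ) {p : ℝ} (hp0 : 0 ≤ p) (hp1 : p ≤ 1) :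
    gnpProb n p {G | ∃ S : Finset (Fin n), S.card ≤ M ∧
        S.card + t ≤ edgeCount (G.induce (↑S : Set (Fin n)))} ≤
      ∑ s ∈ Finset.range (M + 1),
        (n.choose s : ℝ) * ((s ^ 2).choose (s + t) : ℝ) * p ^ (s + t) := by
  refine (gnpProb_le_sum n hp0 hp1 _ (Finset.range (M + 1))
    (fun s => {G | ∃ S : Finset (Fin n), S.card = s ∧
      s + t ≤ edgeCount (G.induce (↑S : Set (Fin n)))}) ?_).trans
    (Finset.sum_le_sum fun s _ => ?_)
  · rintro G ⟨S, hS, hG⟩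
    exact ⟨S.card, Finset.mem_range.2 (Nat.lt_succ_of_le hS), S, rfl, hG⟩
  refine (gnpProb_le_sum n hp0 hp1 _ (Finset.powersetCard s Finset.univ)
    (fun S : Finset (Fin n) => {G | s + t ≤ edgeCount (G.induce (↑S : Set (Fin n)))}) ?_).trans ?_
  · rintro G ⟨S, hS, hG⟩
    exact ⟨S, Finset.mem_powersetCard.2 ⟨Finset.subset_univ _, hS⟩, hG⟩
  have hS : ∀ S ∈ Finset.powersetCard s (Finset.univ : Finset (Fin n)),
      gnpProb n p {G | s + t ≤ edgeCount (G.induce (↑S : Set (Fin n)))} ≤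
        ((s ^ 2).choose (s + t) : ℝ) * p ^ (s + t) := by
    intro S hS
    have hSc : S.card = s := (Finset.mem_powersetCard.1 hS).2
    set T := S.sym2.filter (fun e => ¬ e.IsDiag) with hT
    refine (gnpProb_le_sum n hp0 hp1 _ (Finset.powersetCard (s + t) T)
      (fun F => {G | (F : Set (Sym2 (Fin n))) ⊆ G.edgeSet})
      (fun G hG => exists_edges_of_le_edgeCount_induce G S _ hG)).trans ?_
    have hF : ∀ F ∈ Finset.powersetCard (s + t) T,
        gnpProb n p {G | (F : Set (Sym2 (Fin n))) ⊆ G.edgeSet} = p ^ (s + t) := by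
      intro F hF
      obtain ⟨hF1, hF2⟩ := Finset.mem_powersetCard.1 hF
      rw [gnpProb_subset_edgeSet n p F fun e he => (Finset.mem_filter.1 (hF1 he)).2, hF2]
    rw [Finset.sum_congr rfl hF, Finset.sum_const, Finset.card_powersetCard, nsmul_eq_mul]
    have hTc : T.card ≤ s ^ 2 := by
      refine (Finset.card_le_card (Finset.filter_subset _ _)).trans ?_
      rw [Finset.card_sym2, hSc, Nat.choose_two_right]
      apply Nat.div_le_of_le_mul
      simp only [Nat.add_sub_cancel]
      nlinarith [Nat.zero_le s, Nat.le_self_pow two_ne_zero s]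
    gcongr
  refine (Finset.sum_le_sum hS).trans (le_of_eq ?_)
  rw [Finset.sum_const, Finset.card_powersetCard, Finset.card_univ, Fintype.card_fin,
    nsmul_eq_mul, mul_assoc]

lemma choose_mul_choose_sq_mul_pow_le (n s t : ℕ) {p : ℝ} (hp0 : 0 ≤ p) :
    (n.choose s : ℝ) * ((s ^ 2).choose (s + t) : ℝ) * p ^ (s + t) ≤
      (Real.exp 2 * (n * p)) ^ s * (s * p) ^ t := by
  have h1 : (n.choose s : ℝ) ≤ (n : ℝ) ^ s / s.factorial := Nat.choose_le_pow_div s n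
  have h2 : ((s ^ 2).choose (s + t) : ℝ) ≤ ((s : ℝ) ^ 2) ^ (s + t) / (s + t).factorial := by
    exact_mod_cast Nat.choose_le_pow_div (α := ℝ) (s + t) (s ^ 2)
  have h3 : (s : ℝ) ^ s / s.factorial ≤ Real.exp s :=
    Real.pow_div_factorial_le_exp _ (Nat.cast_nonneg s) s
  have h4 : (s : ℝ) ^ (s + t) / (s + t).factorial ≤ Real.exp s :=
    Real.pow_div_factorial_le_exp _ (Nat.cast_nonneg s) (s + t)
  calc (n.choose s : ℝ) * ((s ^ 2).choose (s + t) : ℝ) * p ^ (s + t)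
      ≤ ((n : ℝ) ^ s / s.factorial) * (((s : ℝ) ^ 2) ^ (s + t) / (s + t).factorial) *
          p ^ (s + t) := by gcongr
    _ = ((s : ℝ) ^ s / s.factorial) * ((s : ℝ) ^ (s + t) / (s + t).factorial) *
          ((n * p) ^ s * (s * p) ^ t) := by ring
    _ ≤ Real.exp s * Real.exp s * ((n * p) ^ s * (s * p) ^ t) := by gcongr
    _ = (Real.exp 2 * (n * p)) ^ s * (s * p) ^ t := by
      rw [mul_pow (Real.exp 2), ← Real.exp_nat_mul, ← Real.exp_add]
      ring_nf

/-- Bound on a single term of the first-moment sum, with `L = log n` and `K` bounding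
`n * p / L`. -/
lemma first_moment_term_le (s t : ℕ) {α β K L n p : ℝ} (hα0 : 0 < α) (hα1 : α < 1)
    (hK : 1 ≤ K) (hL : 1 ≤ L) (hlogL : 1 ≤ Real.log L) (hn : n = Real.exp L) (hp0 : 0 ≤ p)
    (hpK : n * p ≤ K * L)
    (hβ : α * (2 + Real.log K) ≤ (β - α) * Real.log L)
    (hs : (s : ℝ) ≤ α * t * (L / Real.log L)) :
    (Real.exp 2 * (n * p)) ^ s * (s * p) ^ t ≤
      (t * K * L ^ 2) ^ t * Real.exp (-((1 - β) * t * L)) := by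
  have hL0 : 0 < L := by linarith
  have hK0 : 0 < K := by linarith
  have hl0 : 0 < Real.log L := by linarith
  have hn0 : 0 < n := hn ▸ Real.exp_pos L
  have hlK : 0 ≤ Real.log K := Real.log_nonneg hK
  have hA : (Real.exp 2 * (n * p)) ^ s ≤ Real.exp (β * t * L) := by
    have hbase : Real.exp 2 * (n * p) ≤ Real.exp (2 + Real.log K + Real.log L) := by
      rw [Real.exp_add, Real.exp_add, Real.exp_log hK0, Real.exp_log hL0, mul_assoc]
      gcongr
    calc (Real.exp 2 * (n * p)) ^ s ≤ Real.exp (2 + Real.log K + Real.log L) ^ s := by gcongr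
      _ = Real.exp (s * (2 + Real.log K + Real.log L)) := by rw [← Real.exp_nat_mul]
      _ ≤ Real.exp (α * t * (L / Real.log L) * (2 + Real.log K + Real.log L)) := by gcongr
      _ ≤ Real.exp (β * t * L) := by
        apply Real.exp_le_exp.2
        have h : α * (2 + Real.log K + Real.log L) ≤ β * Real.log L := by linarith
        calc α * t * (L / Real.log L) * (2 + Real.log K + Real.log L)
            = t * L / Real.log L * (α * (2 + Real.log K + Real.log L)) := by ring
          _ ≤ t * L / Real.log L * (β * Real.log L) := by gcongr
          _ = β * t * L := by field_simp
  have hsL : (s : ℝ) ≤ t * L := by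
    refine hs.trans ?_
    have h1 : L / Real.log L ≤ L := div_le_self hL0.le hlogL
    calc α * t * (L / Real.log L) ≤ 1 * t * L := by gcongr
      _ = t * L := by ring
  have hB : (s * p) ^ t ≤ (t * K * L ^ 2) ^ t * Real.exp (-(t * L)) := by
    have hp : p ≤ K * L * Real.exp (-L) := by
      rw [Real.exp_neg, ← hn, ← div_eq_mul_inv, le_div_iff₀ hn0]
      linarith
    calc (s * p) ^ t ≤ (t * L * (K * L * Real.exp (-L))) ^ t := by gcongr
      _ = (t * K * L ^ 2) ^ t * Real.exp (-L) ^ t := by rw [← mul_pow]; ring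
      _ = (t * K * L ^ 2) ^ t * Real.exp (-(t * L)) := by
        rw [← Real.exp_nat_mul, mul_neg]
  calc (Real.exp 2 * (n * p)) ^ s * (s * p) ^ t
      ≤ Real.exp (β * t * L) * ((t * K * L ^ 2) ^ t * Real.exp (-(t * L))) := by gcongr
    _ = (t * K * L ^ 2) ^ t * (Real.exp (β * t * L) * Real.exp (-(t * L))) := by ring
    _ = (t * K * L ^ 2) ^ t * Real.exp (-((1 - β) * t * L)) := by
      rw [← Real.exp_add]; ring_nf

lemma tendsto_first_moment_bound (t : ℕ) (ht : 1 ≤ t) {β K : ℝ} (hβ : β < 1) :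
    Tendsto (fun L : ℝ => 2 * (t * L) *
      ((t * K * L ^ 2) ^ t * Real.exp (-((1 - β) * t * L)))) atTop (nhds 0) := by
  have ht0 : (0 : ℝ) < t := by exact_mod_cast ht
  have h := (tendsto_rpow_mul_exp_neg_mul_atTop_nhds_zero ((2 * t + 1 : ℕ) : ℝ) ((1 - β) * t)
    (mul_pos (by linarith) ht0)).const_mul (2 * t * (t * K) ^ t)
  rw [mul_zero] at h
  refine h.congr fun L => ?_
  rw [Real.rpow_natCast, mul_pow _ (L ^ 2), ← pow_mul, pow_succ, neg_mul]
  ring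

/-- For fixed `t ≥ 1` and `0 < α < 1`, almost surely `G(n, p(n))` contains no vertex set `S`
with `|S| ≤ α·t·D` and `e[S] ≥ |S| + t`, where `D = log n / log log n`. -/
theorem no_dense_small_sets_as (k : ℕ) (hk : 1 ≤ k) (t : ℕ) (ht : 1 ≤ t)
    (α : ℝ) (hα0 : 0 < α) (hα1 : α < 1) :
    Tendsto (fun n : ℕ =>
      gnpProb n ((Real.log n + ((k : ℝ) + 1) * Real.log (Real.log n) -
          Real.log (Real.log (Real.log n))) / n)
        {G : SimpleGraph (Fin n) | ¬ ∃ S : Finset (Fin n),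
          (S.card : ℝ) ≤ α * t * (Real.log n / Real.log (Real.log n)) ∧
          S.card + t ≤ edgeCount (G.induce (↑S : Set (Fin n)))})
      atTop (nhds 1) := by
  set L : ℕ → ℝ := fun n => Real.log n with hLdef
  set p : ℕ → ℝ := fun n => (Real.log n + ((k : ℝ) + 1) * Real.log (Real.log n) -
          Real.log (Real.log (Real.log n))) / n with hpdef
  set K : ℝ := k + 2 with hKdef
  set β : ℝ := (1 + α) / 2 with hβdef
  have hK : 1 ≤ K := by
    have : (0 : ℝ) ≤ k := Nat.cast_nonneg k
    linarith
  have hL : Tendsto L atTop atTop := Real.tendsto_log_atTop.comp tendsto_natCast_atTop_atTop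
  have hlL : Tendsto (fun n => Real.log (L n)) atTop atTop := Real.tendsto_log_atTop.comp hL
  have hbound : Tendsto (fun n => 2 * (t * L n) *
      ((t * K * L n ^ 2) ^ t * Real.exp (-((1 - β) * t * L n)))) atTop (nhds 0) :=
    (tendsto_first_moment_bound t ht (by linarith)).comp hL
  have hKL : ∀ᶠ n : ℕ in atTop, K * L n ≤ n := by
    have h := (Real.isLittleO_log_id_atTop.bound (c := K⁻¹) (by positivity))
    filter_upwards [tendsto_natCast_atTop_atTop.eventually h] with n hn
    have hn' : L n ≤ K⁻¹ * n := by
      refine (le_abs_self _).trans (hn.trans (le_of_eq ?_))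
      simp
    calc K * L n ≤ K * (K⁻¹ * n) := by gcongr
      _ = n := by field_simp
  have hmain : ∀ᶠ n in atTop, 1 - 2 * (t * L n) *
      ((t * K * L n ^ 2) ^ t * Real.exp (-((1 - β) * t * L n))) ≤
      gnpProb n (p n) {G : SimpleGraph (Fin n) | ¬ ∃ S : Finset (Fin n),
          (S.card : ℝ) ≤ α * t * (Real.log n / Real.log (Real.log n)) ∧
          S.card + t ≤ edgeCount (G.induce (↑S : Set (Fin n)))} ∧
      gnpProb n (p n) {G : SimpleGraph (Fin n) | ¬ ∃ S : Finset (Fin n),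
          (S.card : ℝ) ≤ α * t * (Real.log n / Real.log (Real.log n)) ∧
          S.card + t ≤ edgeCount (G.induce (↑S : Set (Fin n)))} ≤ 1 := by
    filter_upwards [hKL, hL.eventually_ge_atTop 1, hlL.eventually_ge_atTop 1,
      hlL.eventually_ge_atTop (α * (2 + Real.log K) / (β - α)), eventually_gt_atTop 0]
      with n hKn hL1 hl1 hlc hn0
    have hn0' : (0 : ℝ) < n := by exact_mod_cast hn0
    have hk0 : (0 : ℝ) ≤ k := Nat.cast_nonneg k
    have ht1 : (1 : ℝ) ≤ t := by exact_mod_cast ht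
    have hnp : n * p n = L n + ((k : ℝ) + 1) * Real.log (L n) - Real.log (Real.log (L n)) := by
      simp only [hpdef, hLdef]
      field_simp
    have hl_le : Real.log (L n) ≤ L n := (Real.log_le_self (by linarith))
    have hll_le : Real.log (Real.log (L n)) ≤ Real.log (L n) := Real.log_le_self (by linarith)
    have hll0 : 0 ≤ Real.log (Real.log (L n)) := Real.log_nonneg hl1
    have hnpK : n * p n ≤ K * L n := by
      rw [hnp, hKdef]
      nlinarith
    have hp0 : 0 ≤ p n := by
      have : 0 ≤ n * p n := by rw [hnp]; nlinarith
      exact nonneg_of_mul_nonneg_right this hn0'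
    have hp1 : p n ≤ 1 := by nlinarith
    set A : Set (SimpleGraph (Fin n)) := {G | ¬ ∃ S : Finset (Fin n),
          (S.card : ℝ) ≤ α * t * (Real.log n / Real.log (Real.log n)) ∧
          S.card + t ≤ edgeCount (G.induce (↑S : Set (Fin n)))} with hA
    set m : ℝ := α * t * (Real.log n / Real.log (Real.log n)) with hm
    have hm0 : 0 ≤ m := by
      have : 0 ≤ L n / Real.log (L n) := by positivity
      positivity
    have hmL : m ≤ t * L n := by
      have h1 : L n / Real.log (L n) ≤ L n := div_le_self (by linarith) hl1
      calc m = α * t * (L n / Real.log (L n)) := rfl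
        _ ≤ 1 * t * L n := by gcongr
        _ = t * L n := by ring
    have hAc : Aᶜ = {G | ∃ S : Finset (Fin n), S.card ≤ ⌊m⌋₊ ∧
        S.card + t ≤ edgeCount (G.induce (↑S : Set (Fin n)))} := by
      ext G
      simp only [hA, Set.mem_compl_iff, Set.mem_ofPred_eq, not_not, Nat.le_floor_iff hm0]
    have hsum := gnpProb_add_compl n (p n) A
    have hnn := gnpProb_nonneg n hp0 hp1 Aᶜ
    have hbad : gnpProb n (p n) Aᶜ ≤ 2 * (t * L n) *
        ((t * K * L n ^ 2) ^ t * Real.exp (-((1 - β) * t * L n))) := by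
      rw [hAc]
      refine (gnpProb_exists_dense_le n t ⌊m⌋₊ hp0 hp1).trans ?_
      have hterm : ∀ s ∈ Finset.range (⌊m⌋₊ + 1),
          (n.choose s : ℝ) * ((s ^ 2).choose (s + t) : ℝ) * p n ^ (s + t) ≤
            (t * K * L n ^ 2) ^ t * Real.exp (-((1 - β) * t * L n)) := by
        intro s hs
        refine (choose_mul_choose_sq_mul_pow_le n s t hp0).trans
          (first_moment_term_le s t hα0 hα1 hK hL1 hl1 (Real.exp_log hn0').symm hp0 hnpK ?_ ?_)
        · rw [div_le_iff₀ (by linarith)] at hlc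
          linarith
        · exact (Nat.le_floor_iff hm0).1 (Nat.lt_succ_iff.1 (Finset.mem_range.1 hs))
      refine (Finset.sum_le_card_nsmul _ _ _ hterm).trans ?_
      rw [Finset.card_range, nsmul_eq_mul]
      have hcount : ((⌊m⌋₊ + 1 : ℕ) : ℝ) ≤ 2 * (t * L n) := by
        push_cast
        have h1 := Nat.floor_le hm0
        nlinarith
      gcongr
    constructor <;> linarith
  have hlow : Tendsto (fun n => 1 - 2 * (t * L n) *
      ((t * K * L n ^ 2) ^ t * Real.exp (-((1 - β) * t * L n)))) atTop (nhds 1) := by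
    simpa using hbound.const_sub 1
  exact tendsto_of_tendsto_of_tendsto_of_le_of_le' hlow tendsto_const_nhds
    (hmain.mono fun n h => h.1) (hmain.mono fun n h => h.2)
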